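/- arXiv:1111.2202 — 3 statements merged into one kernel-verified Lean document; each statement's English description precedes it below -/
import Mathlib

section
/- Let F : ℝ → ℝ be differentiable and satisfy (y₁ − y₂)(F(y₁) − F(y₂)) ≤ 0 for all y₁, y₂ ∈ ℝ. For n ≥ 1 let F_n be the linear truncation of F outside [−n,n], i.e. F_n(y) = F(y) for |y| ≤ n and F_n(y) = F(n·sgn(y)) + F'(n·sgn(y))·(y − n·sgn(y)) for |y| > n. Then F_n satisfies the same monotonicity condition: (y₁ − y₂)(F_n(y₁) − F_n(y₂)) ≤ 0 for all y₁, y₂ ∈ ℝ. -/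
/-- The linear truncation of `F` outside `[-n, n]`. -/
noncomputable def linTrunc (F : ℝ → ℝ) (n : ℕ) (y : ℝ) : ℝ :=
  if |y| ≤ n then F y
  else F (n * Real.sign y) + deriv F (n * Real.sign y) * (y - n * Real.sign y)

theorem antitone_of_mul_sub_nonpos {F : ℝ → ℝ}
    (hmono : ∀ y₁ y₂ : ℝ, (y₁ - y₂) * (F y₁ - F y₂) ≤ 0) : Antitone F := by
  intro x y hxy
  rcases hxy.eq_or_lt with rfl | hlt
  · exact le_rfl
  · have h := hmono y x
    have := nonpos_of_mul_nonpos_right h (sub_pos.2 hlt)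
    linarith

theorem linTrunc_of_le_neg (F : ℝ → ℝ) {n : ℕ} {y : ℝ} (hy : y ≤ -n) :
    linTrunc F n y = F (-n) + deriv F (-n) * (y + n) := by
  have hn : (0 : ℝ) ≤ n := n.cast_nonneg
  rcases hy.eq_or_lt with rfl | hlt
  · simp [linTrunc]
  · have habs : ¬ |y| ≤ n := fun h => by linarith [(abs_le.1 h).1]
    rw [linTrunc, if_neg habs, Real.sign_of_neg (show y < 0 by linarith)]
    simp

theorem linTrunc_of_le (F : ℝ → ℝ) {n : ℕ} {y : ℝ} (hy : n ≤ y) :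
    linTrunc F n y = F n + deriv F n * (y - n) := by
  have hn : (0 : ℝ) ≤ n := n.cast_nonneg
  rcases hy.eq_or_lt with rfl | hlt
  · simp [linTrunc]
  · have habs : ¬ |y| ≤ n := fun h => by linarith [(abs_le.1 h).2]
    rw [linTrunc, if_neg habs, Real.sign_of_pos (show 0 < y by linarith)]
    simp

theorem linTrunc_of_mem_Icc (F : ℝ → ℝ) {n : ℕ} {y : ℝ} (hy : y ∈ Set.Icc (-n : ℝ) n) :
    linTrunc F n y = F y :=
  if_pos (abs_le.2 hy)

theorem antitone_linTrunc {F : ℝ → ℝ} (hF : Antitone F) (n : ℕ) :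
    Antitone (linTrunc F n) := by
  have hn : (0 : ℝ) ≤ n := n.cast_nonneg
  have hderiv (x : ℝ) : deriv F x ≤ 0 := hF.deriv_nonpos
  have hleft : AntitoneOn (linTrunc F n) (Set.Iic (-n : ℝ)) := by
    intro x hx y hy hxy
    rw [linTrunc_of_le_neg F hx, linTrunc_of_le_neg F hy]
    have := mul_le_mul_of_nonpos_left (add_le_add_left hxy (n : ℝ)) (hderiv (-n))
    linarith
  have hmid : AntitoneOn (linTrunc F n) (Set.Icc (-n : ℝ) n) := by
    intro x hx y hy hxy
    rw [linTrunc_of_mem_Icc F hx, linTrunc_of_mem_Icc F hy]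
    exact hF hxy
  have hright : AntitoneOn (linTrunc F n) (Set.Ici (n : ℝ)) := by
    intro x hx y hy hxy
    rw [linTrunc_of_le F hx, linTrunc_of_le F hy]
    have := mul_le_mul_of_nonpos_left (sub_le_sub_right hxy (n : ℝ)) (hderiv n)
    linarith
  have hle : (-n : ℝ) ≤ n := by linarith
  have hIic : AntitoneOn (linTrunc F n) (Set.Iic (n : ℝ)) := by
    rw [← Set.Iic_union_Icc_eq_Iic hle]
    exact hleft.union_right hmid isGreatest_Iic (isLeast_Icc hle)
  exact hIic.Iic_union_Ici hright

/-- the linear truncation preserves the monotonicity condition. -/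
theorem linTrunc_monotone (F : ℝ → ℝ) (hF : Differentiable ℝ F)
    (hmono : ∀ y₁ y₂ : ℝ, (y₁ - y₂) * (F y₁ - F y₂) ≤ 0)
    (n : ℕ) (hn : 1 ≤ n) :
    ∀ y₁ y₂ : ℝ, (y₁ - y₂) * (linTrunc F n y₁ - linTrunc F n y₂) ≤ 0 := by
  intro y₁ y₂
  have hanti := antitone_linTrunc (antitone_of_mul_sub_nonpos hmono) n
  rcases le_total y₁ y₂ with h | h
  · exact mul_nonpos_of_nonpos_of_nonneg (sub_nonpos.2 h) (sub_nonneg.2 (hanti h))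
  · exact mul_nonpos_of_nonneg_of_nonpos (sub_nonneg.2 h) (sub_nonpos.2 (hanti h))
end

section
/- Let p ≥ 2, L > 0, c ≥ 0 be real numbers and let F : ℝ → ℝ be differentiable with |F(y)| ≤ L(c + |y|^p) and |F'(y)| ≤ L(1 + |y|^{p−1}) for all y ∈ ℝ. For n ≥ 1 let F_n be the linear truncation of F outside [−n,n]. Then for all y ∈ ℝ, |F_n(y)| ≤ L( c + (2·(min(n,|y|))^{p−1} + 1)·|y| ). -/
/-- growth bound for the linear truncation. -/
theorem linTrunc_growth (p L c : ℝ) (hp : 2 ≤ p) (hL : 0 < L) (hc : 0 ≤ c)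
    (F : ℝ → ℝ) (hF : Differentiable ℝ F)
    (hFg : ∀ y : ℝ, |F y| ≤ L * (c + |y| ^ p))
    (hF'g : ∀ y : ℝ, |deriv F y| ≤ L * (1 + |y| ^ (p - 1)))
    (n : ℕ) (hn : 1 ≤ n) :
    ∀ y : ℝ, |linTrunc F n y| ≤ L * (c + (2 * (min (n : ℝ) |y|) ^ (p - 1) + 1) * |y|) := by
  intro y
  have rpow_split : ∀ x : ℝ, 0 ≤ x → x ^ p = x ^ (p - 1) * x := fun x hx => by
    rw [← Real.rpow_add_one' hx (by linarith), sub_add_cancel]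
  unfold linTrunc
  split_ifs with h
  · rw [min_eq_right h]
    refine (hFg y).trans (mul_le_mul_of_nonneg_left ?_ hL.le)
    rw [rpow_split _ (abs_nonneg y)]
    have := mul_nonneg (Real.rpow_nonneg (abs_nonneg y) (p - 1)) (abs_nonneg y)
    linarith [abs_nonneg y]
  · push Not at h
    rw [min_eq_left h.le]
    have hn0 : (0 : ℝ) ≤ n := n.cast_nonneg
    obtain ⟨hs, hd⟩ : |(n : ℝ) * Real.sign y| = n ∧ |y - n * Real.sign y| = |y| - n := by
      rcases lt_trichotomy y 0 with hy | rfl | hy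
      · rw [abs_of_neg hy] at h ⊢
        rw [Real.sign_of_neg hy, mul_neg_one, abs_neg, abs_of_nonneg hn0,
          abs_of_nonpos (by linarith)]
        exact ⟨rfl, by ring⟩
      · rw [abs_zero] at h
        linarith
      · rw [abs_of_pos hy] at h ⊢
        rw [Real.sign_of_pos hy, mul_one, abs_of_nonneg hn0, abs_of_nonneg (by linarith)]
        exact ⟨rfl, rfl⟩
    have hFs := hFg (n * Real.sign y)
    have hF's := hF'g (n * Real.sign y)
    rw [hs] at hFs hF's
    rw [rpow_split _ hn0] at hFs
    have hpow : (0 : ℝ) ≤ (n : ℝ) ^ (p - 1) := Real.rpow_nonneg hn0 _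
    calc _ ≤ |F (n * Real.sign y)| + |deriv F (n * Real.sign y)| * (|y| - n) := by
          rw [← hd, ← abs_mul]
          exact abs_add_le _ _
      _ ≤ L * (c + (n : ℝ) ^ (p - 1) * n) + L * (1 + (n : ℝ) ^ (p - 1)) * (|y| - n) :=
          add_le_add hFs (mul_le_mul_of_nonneg_right hF's (by linarith))
      _ = L * (c + (n : ℝ) ^ (p - 1) * |y| + (|y| - n)) := by ring
      _ ≤ _ := by
          refine mul_le_mul_of_nonneg_left ?_ hL.le
          have := mul_nonneg hpow (abs_nonneg y)
          linarith
end

section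
/- Let T > 0, p ≥ 2, L > 0, and let f : [0,T] × ℝ^d × ℝ → ℝ be differentiable in the last variable with partial derivative ∂_y f, satisfying for all s ∈ [0,T], x₁, x₂ ∈ ℝ^d, y ∈ ℝ: |f(s,x₁,y) − f(s,x₂,y)| ≤ L(1 + |y|^p)|x₁ − x₂| and |∂_y f(s,x₁,y) − ∂_y f(s,x₂,y)| ≤ L(1 + |y|^{p−1})|x₁ − x₂|. For n ≥ 1 define f_n(s,x,·) as the linear truncation of f(s,x,·) outside [−n,n]. Then for all s ∈ [0,T], x₁, x₂ ∈ ℝ^d, y ∈ ℝ: |f_n(s,x₁,y) − f_n(s,x₂,y)| ≤ 3L(1 + |y|^p)|x₁ − x₂|. -/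
/-- Beyond the truncation level, the distance of `y` to `n * sign y` is `|y| - n`. -/
theorem abs_sub_mul_sign {c y : ℝ} (hc : 0 < c) (hy : c < |y|) :
    |c * Real.sign y| = c ∧ |y - c * Real.sign y| = |y| - c := by
  rcases lt_trichotomy y 0 with h | rfl | h
  · rw [abs_of_neg h] at hy
    rw [Real.sign_of_neg h, abs_of_neg h, abs_of_neg (by linarith), abs_of_neg (by linarith)]
    constructor <;> ring
  · rw [abs_zero] at hy
    exact absurd hy hc.le.not_gt
  · rw [abs_of_pos h] at hy
    rw [Real.sign_of_pos h, abs_of_pos h, abs_of_pos (by linarith), abs_of_pos (by linarith)]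
    constructor <;> ring

/-- The affine extension of the weight `1 + c ^ p` grows no faster than `3 * (1 + a ^ p)`. -/
theorem one_add_rpow_affine_le {p c a : ℝ} (hp : 1 ≤ p) (hc : 1 ≤ c) (hca : c ≤ a) :
    (1 + c ^ p) + (1 + c ^ (p - 1)) * (a - c) ≤ 3 * (1 + a ^ p) := by
  have ha : 1 ≤ a := hc.trans hca
  have h₁ : c ^ p ≤ a ^ p := Real.rpow_le_rpow (by linarith) hca (by linarith)
  have h₂ : c ^ (p - 1) ≤ a ^ (p - 1) := Real.rpow_le_rpow (by linarith) hca (by linarith)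
  have h₃ : a ^ (p - 1) * a = a ^ p := by
    rw [Real.rpow_sub_one (by linarith), div_mul_cancel₀ _ (by linarith)]
  have h₄ : a ≤ a ^ p := Real.self_le_rpow_of_one_le ha hp
  have h₅ : 0 ≤ c ^ (p - 1) := Real.rpow_nonneg (by linarith) _
  have h₆ : (1 + c ^ (p - 1)) * (a - c) ≤ (1 + a ^ (p - 1)) * a :=
    mul_le_mul (by linarith) (by linarith) (by linarith) (by linarith)
  nlinarith

/-- spatial Lipschitz estimate for the truncated coefficient `f_n`. -/
theorem linTrunc_space_lipschitz (d : ℕ) (T p L : ℝ) (hT : 0 < T) (hp : 2 ≤ p) (hL : 0 < L)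
    (f : ℝ → EuclideanSpace ℝ (Fin d) → ℝ → ℝ)
    (hdiff : ∀ (s : ℝ) (x : EuclideanSpace ℝ (Fin d)), Differentiable ℝ (f s x))
    (hlipx : ∀ s ∈ Set.Icc (0:ℝ) T, ∀ (x₁ x₂ : EuclideanSpace ℝ (Fin d)) (y : ℝ),
      |f s x₁ y - f s x₂ y| ≤ L * (1 + |y| ^ p) * ‖x₁ - x₂‖)
    (hlipx' : ∀ s ∈ Set.Icc (0:ℝ) T, ∀ (x₁ x₂ : EuclideanSpace ℝ (Fin d)) (y : ℝ),
      |deriv (f s x₁) y - deriv (f s x₂) y| ≤ L * (1 + |y| ^ (p - 1)) * ‖x₁ - x₂‖)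
    (n : ℕ) (hn : 1 ≤ n) :
    ∀ s ∈ Set.Icc (0:ℝ) T, ∀ (x₁ x₂ : EuclideanSpace ℝ (Fin d)) (y : ℝ),
      |linTrunc (f s x₁) n y - linTrunc (f s x₂) n y| ≤ 3 * L * (1 + |y| ^ p) * ‖x₁ - x₂‖ := by
  intro s hs x₁ x₂ y
  have hn' : (1 : ℝ) ≤ n := by exact_mod_cast hn
  unfold linTrunc
  split_ifs with hy
  · refine (hlipx s hs x₁ x₂ y).trans ?_
    have : 0 ≤ L * (1 + |y| ^ p) * ‖x₁ - x₂‖ := by positivity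
    linarith
  · have hy' : (n : ℝ) < |y| := not_le.mp hy
    obtain ⟨h₁, h₂⟩ := abs_sub_mul_sign (by linarith) hy'
    have hf := hlipx s hs x₁ x₂ (n * Real.sign y)
    have hf' := hlipx' s hs x₁ x₂ (n * Real.sign y)
    rw [h₁] at hf hf'
    generalize (n : ℝ) * Real.sign y = z at *
    calc |f s x₁ z + deriv (f s x₁) z * (y - z) - (f s x₂ z + deriv (f s x₂) z * (y - z))|
        = |(f s x₁ z - f s x₂ z) + (deriv (f s x₁) z - deriv (f s x₂) z) * (y - z)| := by
          congr 1; ring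
      _ ≤ |f s x₁ z - f s x₂ z| + |deriv (f s x₁) z - deriv (f s x₂) z| * |y - z| := by
          rw [← abs_mul]; exact abs_add_le _ _
      _ ≤ L * (1 + (n : ℝ) ^ p) * ‖x₁ - x₂‖
            + L * (1 + (n : ℝ) ^ (p - 1)) * ‖x₁ - x₂‖ * (|y| - n) := by
          rw [h₂]
          exact add_le_add hf (mul_le_mul_of_nonneg_right hf' (by linarith))
      _ = L * ‖x₁ - x₂‖ * ((1 + (n : ℝ) ^ p) + (1 + (n : ℝ) ^ (p - 1)) * (|y| - n)) := by ring
      _ ≤ L * ‖x₁ - x₂‖ * (3 * (1 + |y| ^ p)) :=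
          mul_le_mul_of_nonneg_left (one_add_rpow_affine_le (by linarith) hn' hy'.le)
            (by positivity)
      _ = 3 * L * (1 + |y| ^ p) * ‖x₁ - x₂‖ := by ring
end
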